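/- For every positive integer t, the function g_t whose graph is the grid parabola P_t satisfies g_t(x + H_t) = g_t(x) + x + (H_t − t)/2 for all real x. (Note that (H_t − t)/2 is an integer since H_t ≡ t (mod 2); consequently the affine map (x, y) ↦ (x + H_t, y + x + (H_t − t)/2) maps ℤ² to itself and maps both P_t and every vertical translate of the parabola y = (x − t/2)²/(2H_t) to itself.) -/

import Mathlib

/-- Horizontal length of the edge of slope a/b (in lowest terms, 1 ≤ b ≤ t)
of the grid parabola P_t: `b·⌊t/b⌋`. -/
def edgeLen (t b : ℕ) : ℕ := b * (t / b)

/-- The x-coordinate of the left endpoint of the edge of slope a/b of the grid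
parabola P_t (normalized so that the edge of slope 0 is [0,t]): it is t plus the
total horizontal length of all edges of slopes strictly between 0 and a/b. -/
noncomputable def leftEnd (t a b : ℕ) : ℝ :=
  (t : ℝ) + ∑ q ∈ (Finset.Icc 1 t ×ˢ Finset.Icc 1 (a * t)).filter
      (fun q => Nat.gcd q.2 q.1 = 1 ∧ q.2 * b < a * q.1),
    (edgeLen t q.1 : ℝ)

/-- The right half of the grid parabola: for x ≥ t, sum over all primitive slopes
a/b (a ≥ 1, 1 ≤ b ≤ t) of the vertical rise accumulated by the edge of slope a/b
up to abscissa x. -/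
noncomputable def gR (t : ℕ) (x : ℝ) : ℝ :=
  ∑' p : ℕ × ℕ,
    if 1 ≤ p.1 ∧ 1 ≤ p.2 ∧ p.2 ≤ t ∧ Nat.gcd p.1 p.2 = 1 then
      ((p.1 : ℝ) / (p.2 : ℝ)) *
        min (max (x - leftEnd t p.1 p.2) 0) ((edgeLen t p.2 : ℕ) : ℝ)
    else 0

/-- The convex piecewise-linear function `g_t` whose graph is the grid parabola
P_t : for each rational slope a/b in lowest terms with 1 ≤ b ≤ t there is exactly
one edge of slope a/b, of horizontal length b·⌊t/b⌋, the edges occurring in order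
of increasing slope; normalized so that g_t = 0 exactly on [0,t].  The left half
is obtained from the right half by the symmetry x ↦ t - x. -/
noncomputable def gridParabola (t : ℕ) (x : ℝ) : ℝ :=
  if x ≤ (t : ℝ) / 2 then gR t ((t : ℝ) - x) else gR t x

/-- The horizontal period `H_t = Σ ⌊t/x⌋·x` over pairs `1 ≤ y ≤ x ≤ t` with `gcd(x,y) = 1`. -/
def Hper (t : ℕ) : ℕ :=
  ∑ p ∈ (Finset.Icc 1 t ×ˢ Finset.Icc 1 t).filter
      (fun p => p.2 ≤ p.1 ∧ Nat.gcd p.1 p.2 = 1),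
    (t / p.1) * p.1

namespace GP

noncomputable def l (t : ℕ) (q : ℚ) : ℝ := (edgeLen t q.den : ℝ)

theorem fin (t : ℕ) (u v : ℚ) : {q : ℚ | u ≤ q ∧ q < v ∧ q.den ≤ t}.Finite := by
  obtain ⟨M, hM⟩ := exists_nat_gt (max |u| |v|)
  have hu : |u| < M := lt_of_le_of_lt (le_max_left _ _) hM
  have hv : |v| < M := lt_of_le_of_lt (le_max_right _ _) hM
  rw [abs_lt] at hu hv
  apply Set.Finite.subset (((Finset.Icc (-(M * t : ℤ)) (M * t)) ×ˢ (Finset.Icc 1 t)).image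
    (fun p : ℤ × ℕ => (p.1 : ℚ) / (p.2 : ℚ))).finite_toSet
  rintro q ⟨h1, h2, h3⟩
  simp only [Finset.coe_image, Set.mem_image, Finset.mem_coe, Finset.mem_product, Finset.mem_Icc]
  refine ⟨(q.num, q.den), ⟨⟨?_, ?_⟩, q.den_pos, h3⟩, Rat.num_div_den q⟩
  · have hd : (0 : ℚ) < q.den := by exact_mod_cast q.den_pos
    have h3' : (q.den : ℚ) ≤ t := by exact_mod_cast h3
    have : (q.num : ℚ) = q * q.den := (Rat.mul_den_eq_num q).symm
    have h : (-(M * t : ℤ) : ℚ) ≤ q.num := by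
      rw [this]; push_cast
      have hM0 : (0 : ℚ) ≤ M := by positivity
      nlinarith
    exact_mod_cast h
  · have hd : (0 : ℚ) < q.den := by exact_mod_cast q.den_pos
    have h3' : (q.den : ℚ) ≤ t := by exact_mod_cast h3
    have : (q.num : ℚ) = q * q.den := (Rat.mul_den_eq_num q).symm
    have h : (q.num : ℚ) ≤ ((M * t : ℤ) : ℚ) := by
      rw [this]; push_cast
      have hM0 : (0 : ℚ) ≤ M := by positivity
      nlinarith
    exact_mod_cast h

noncomputable def G (t : ℕ) (u v : ℚ) : Finset ℚ := (fin t u v).toFinset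

theorem mem_G {t : ℕ} {u v q : ℚ} : q ∈ G t u v ↔ u ≤ q ∧ q < v ∧ q.den ≤ t := by
  simp [G]

noncomputable def L (t : ℕ) (q : ℚ) : ℝ := ∑ r ∈ G t 0 q, l t r

noncomputable def c (t : ℕ) (x : ℝ) (q : ℚ) : ℝ := min (max (x - L t q) 0) (l t q)

theorem l_nonneg (t : ℕ) (q : ℚ) : 0 ≤ l t q := by unfold l; positivity

theorem den_add_one (q : ℚ) : (q + 1).den = q.den := by
  have := Rat.add_intCast_den q 1
  simpa using this

theorem den_one_sub (q : ℚ) : (1 - q).den = q.den := by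
  rw [show (1 - q) = -q + 1 by ring, den_add_one, Rat.neg_den]

theorem sum_split (t : ℕ) (f : ℚ → ℝ) {u v w : ℚ} (h1 : u ≤ v) (h2 : v ≤ w) :
    ∑ r ∈ G t u w, f r = ∑ r ∈ G t u v, f r + ∑ r ∈ G t v w, f r := by
  rw [← Finset.sum_union]
  · congr 1
    ext q
    simp only [Finset.mem_union, mem_G]
    grind
  · rw [Finset.disjoint_left]
    intro q
    simp only [mem_G]
    grind

theorem sum_shift (t : ℕ) (f : ℚ → ℝ) (u v : ℚ) :
    ∑ r ∈ G t (u + 1) (v + 1), f r = ∑ r ∈ G t u v, f (r + 1) := by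
  symm
  refine Finset.sum_bij' (fun q _ => q + 1) (fun q _ => q - 1) ?_ ?_ ?_ ?_ ?_
  · intro q; simp only [mem_G, den_add_one]; grind
  · intro q; simp only [mem_G]
    rw [show q.den = (q - 1).den by rw [← den_add_one (q - 1)]; simp]; grind
  · simp
  · simp
  · simp

theorem l_add_one (t : ℕ) (q : ℚ) : l t (q + 1) = l t q := by
  simp [l, den_add_one]

theorem L_add_one (t : ℕ) {q : ℚ} (hq : 0 ≤ q) : L t (q + 1) = L t q + L t 1 := by
  unfold L
  rw [sum_split t _ (v := 1) zero_le_one (by linarith)]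
  have := sum_shift t (l t) 0 q
  rw [zero_add] at this
  rw [this]
  simp only [l_add_one]
  ring

theorem L_zero (t : ℕ) : L t 0 = 0 := by
  unfold L
  apply Finset.sum_eq_zero
  intro q; rw [mem_G]; grind

theorem L_mono (t : ℕ) {p q : ℚ} (hp : 0 ≤ p) (h : p ≤ q) : L t p ≤ L t q := by
  unfold L
  rw [sum_split t _ hp h]
  have : 0 ≤ ∑ r ∈ G t p q, l t r := Finset.sum_nonneg (fun r _ => l_nonneg t r)
  linarith

theorem L_nat (t n : ℕ) : L t n = n * L t 1 := by
  induction n with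
  | zero => simp [L_zero]
  | succ n ih => push_cast; rw [L_add_one t (by positivity), ih]; ring

theorem c_shift (t : ℕ) (x : ℝ) {q : ℚ} (hq : 0 ≤ q) : c t (x + L t 1) (q + 1) = c t x q := by
  unfold c; rw [L_add_one t hq, l_add_one]; congr 2; ring

theorem l_zero {t : ℕ} : l t 0 = t := by simp [l, edgeLen]

theorem tile_aux (f : ℚ → ℝ) (hf : ∀ q, 0 ≤ f q) (x : ℝ) (s : Finset ℚ) :
    ∑ q ∈ s, min (max (x - ∑ r ∈ s with r < q, f r) 0) (f q) = min (max x 0) (∑ q ∈ s, f q) := by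
  induction s using Finset.induction_on_max with
  | empty => simp
  | insert a s ha ih =>
    have hn : a ∉ s := fun h => lt_irrefl _ (ha a h)
    rw [Finset.sum_insert hn, Finset.sum_insert hn]
    have e1 : (insert a s).filter (· < a) = s := by
      ext q; simp only [Finset.mem_filter, Finset.mem_insert]; grind
    have e2 : ∀ q ∈ s, (insert a s).filter (· < q) = s.filter (· < q) := by
      intro q hq; ext r; simp only [Finset.mem_filter, Finset.mem_insert]; grind
    have e3 : ∑ q ∈ s, min (max (x - ∑ r ∈ insert a s with r < q, f r) 0) (f q)
        = ∑ q ∈ s, min (max (x - ∑ r ∈ s with r < q, f r) 0) (f q) :=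
      Finset.sum_congr rfl (fun q hq => by rw [e2 q hq])
    rw [e1, e3, ih]
    have h1 := hf a
    have h2 : 0 ≤ ∑ q ∈ s, f q := Finset.sum_nonneg (fun r _ => hf r)
    clear ih e1 e2 e3 hn ha
    generalize ∑ q ∈ s, f q = S at *
    generalize f a = z at *
    clear hf
    grind

theorem tile (t : ℕ) (x : ℝ) (v : ℚ) : ∑ q ∈ G t 0 v, c t x q = min (max x 0) (L t v) := by
  unfold L
  rw [← tile_aux (l t) (l_nonneg t)]
  apply Finset.sum_congr rfl
  intro q hq
  unfold c L
  congr 5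
  rw [mem_G] at hq
  ext r; simp only [Finset.mem_filter, mem_G]; grind

theorem zero_mem (t : ℕ) (ht : 0 < t) {v : ℚ} (hv : 0 < v) : (0 : ℚ) ∈ G t 0 v := by
  rw [mem_G]; simp; grind

theorem leftEnd_eq (t : ℕ) (ht : 0 < t) (a b : ℕ) (ha : 1 ≤ a) (hb : 1 ≤ b) :
    leftEnd t a b = L t ((a : ℚ) / b) := by
  have hb' : (0 : ℚ) < b := by exact_mod_cast hb
  have ha' : (0 : ℚ) < a := by exact_mod_cast ha
  unfold leftEnd L
  rw [← Finset.add_sum_erase _ _ (zero_mem t ht (by positivity)), l_zero]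
  congr 1
  symm
  refine Finset.sum_bij' (fun q _ => (q.den, q.num.toNat)) (fun p _ => (p.2 : ℚ) / (p.1 : ℚ)) ?_ ?_ ?_ ?_ ?_
  · intro q hq
    rw [Finset.mem_erase, mem_G] at hq
    obtain ⟨h0, h1, h2, h3⟩ := hq
    have hn : 0 < q.num := Rat.num_pos.mpr (lt_of_le_of_ne h1 (Ne.symm h0))
    obtain ⟨n, hnn⟩ := Int.eq_ofNat_of_zero_le hn.le
    have hcop := q.reduced
    have hd := q.den_pos
    have key : n * b < a * q.den := by
      rw [← Rat.num_div_den q, hnn, div_lt_div_iff₀ (by exact_mod_cast hd) hb'] at h2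
      exact_mod_cast h2
    rw [hnn] at hcop
    simp only [hnn, Finset.mem_filter, Finset.mem_product, Finset.mem_Icc]
    refine ⟨⟨⟨hd, h3⟩, by omega, ?_⟩, by simpa using hcop, by simpa using key⟩
    simp only [Int.toNat_natCast, Int.ofNat_eq_natCast]
    have : n * 1 ≤ n * b := Nat.mul_le_mul_left _ hb
    have : a * q.den ≤ a * t := Nat.mul_le_mul_left _ h3
    omega
  · rintro ⟨d, n⟩ h
    simp only [Finset.mem_filter, Finset.mem_product, Finset.mem_Icc] at h
    obtain ⟨⟨⟨h1, h2⟩, h3, h4⟩, h5, h6⟩ := h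
    have hd' : (0 : ℚ) < d := by exact_mod_cast h1
    have hn' : (0 : ℚ) < n := by exact_mod_cast h3
    rw [Finset.mem_erase, mem_G]
    refine ⟨by positivity, by positivity, ?_, ?_⟩
    · rw [div_lt_div_iff₀ hd' hb']; exact_mod_cast h6
    · have := Rat.den_div_eq_of_coprime (a := n) (b := d) (by exact_mod_cast h1) (by simpa using h5)
      simp only [Int.cast_natCast] at this
      have h : (((n : ℚ) / d).den : ℤ) ≤ t := by rw [this]; exact_mod_cast h2
      exact_mod_cast h
  · intro q hq
    rw [Finset.mem_erase, mem_G] at hq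
    have hn : 0 ≤ q.num := Rat.num_nonneg.mpr hq.2.1
    obtain ⟨n, hnn⟩ := Int.eq_ofNat_of_zero_le hn
    conv_rhs => rw [← Rat.num_div_den q]
    simp [hnn]
  · rintro ⟨d, n⟩ h
    simp only [Finset.mem_filter, Finset.mem_product, Finset.mem_Icc] at h
    obtain ⟨⟨⟨h1, h2⟩, h3, h4⟩, h5, h6⟩ := h
    have e1 := Rat.den_div_eq_of_coprime (a := n) (b := d) (by exact_mod_cast h1) (by simpa using h5)
    have e2 := Rat.num_div_eq_of_coprime (a := n) (b := d) (by exact_mod_cast h1) (by simpa using h5)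
    simp only [Int.cast_natCast] at e1 e2
    ext
    · exact_mod_cast e1
    · simp [e2]
  · intro q hq
    rfl

theorem Hper_eq (t : ℕ) : (Hper t : ℝ) = L t 1 := by
  unfold Hper L
  push_cast
  refine Finset.sum_bij' (fun p _ => 1 - (p.2 : ℚ) / (p.1 : ℚ))
    (fun q _ => (q.den, (1 - q).num.toNat)) ?_ ?_ ?_ ?_ ?_
  · rintro ⟨d, n⟩ h
    simp only [Finset.mem_filter, Finset.mem_product, Finset.mem_Icc] at h
    obtain ⟨⟨⟨h1, h2⟩, h3, h4⟩, h5, h6⟩ := h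
    have hd' : (0 : ℚ) < d := by exact_mod_cast h1
    have hn' : (0 : ℚ) < n := by exact_mod_cast h3
    have e1 := Rat.den_div_eq_of_coprime (a := n) (b := d) (by exact_mod_cast h1)
      (by simpa using Nat.Coprime.symm h6)
    simp only [Int.cast_natCast] at e1
    rw [mem_G, den_one_sub]
    refine ⟨?_, ?_, ?_⟩
    · have : (n : ℚ) / d ≤ 1 := by rw [div_le_one hd']; exact_mod_cast h5
      linarith
    · have : 0 < (n : ℚ) / d := by positivity
      linarith
    · have h : (((n : ℚ) / d).den : ℤ) ≤ t := by rw [e1]; exact_mod_cast h2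
      exact_mod_cast h
  · intro q hq
    rw [mem_G] at hq
    obtain ⟨h1, h2, h3⟩ := hq
    have hn : 0 < (1 - q).num := Rat.num_pos.mpr (by linarith)
    obtain ⟨n, hnn⟩ := Int.eq_ofNat_of_zero_le hn.le
    have hcop := (1 - q).reduced
    have hd := q.den_pos
    have hle : n ≤ q.den := by
      have : 1 - q ≤ 1 := by linarith
      rw [← Rat.num_div_den (1 - q), hnn, den_one_sub, div_le_one (by exact_mod_cast hd)] at this
      exact_mod_cast this
    rw [hnn, den_one_sub] at hcop
    simp only [hnn, Finset.mem_filter, Finset.mem_product, Finset.mem_Icc,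
      Int.toNat_natCast, Int.ofNat_eq_natCast]
    refine ⟨⟨⟨hd, h3⟩, by omega, by omega⟩, hle, by simpa using hcop.symm⟩
  · rintro ⟨d, n⟩ h
    simp only [Finset.mem_filter, Finset.mem_product, Finset.mem_Icc] at h
    obtain ⟨⟨⟨h1, h2⟩, h3, h4⟩, h5, h6⟩ := h
    have e1 := Rat.den_div_eq_of_coprime (a := n) (b := d) (by exact_mod_cast h1)
      (by simpa using Nat.Coprime.symm h6)
    have e2 := Rat.num_div_eq_of_coprime (a := n) (b := d) (by exact_mod_cast h1)
      (by simpa using Nat.Coprime.symm h6)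
    simp only [Int.cast_natCast] at e1 e2
    ext
    · simp only [den_one_sub]; exact_mod_cast e1
    · simp [e2]
  · intro q hq
    rw [mem_G] at hq
    have hn : 0 ≤ (1 - q).num := Rat.num_nonneg.mpr (by linarith)
    obtain ⟨n, hnn⟩ := Int.eq_ofNat_of_zero_le hn
    have := Rat.num_div_den (1 - q)
    rw [den_one_sub, hnn] at this
    simp only [hnn, Int.toNat_natCast, Int.ofNat_eq_natCast] at *
    push_cast at this
    rw [this]; ring
  · rintro ⟨d, n⟩ h
    simp only [Finset.mem_filter, Finset.mem_product, Finset.mem_Icc] at h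
    obtain ⟨⟨⟨h1, h2⟩, h3, h4⟩, h5, h6⟩ := h
    have e1 := Rat.den_div_eq_of_coprime (a := n) (b := d) (by exact_mod_cast h1)
      (by simpa using Nat.Coprime.symm h6)
    simp only [Int.cast_natCast] at e1
    have e : ((n : ℚ) / d).den = d := by exact_mod_cast e1
    simp only [l, den_one_sub, e, edgeLen]
    push_cast; ring

theorem gR_eq (t : ℕ) (ht : 0 < t) (x : ℝ) (N : ℕ) (hx : x ≤ L t N) :
    gR t x = ∑ q ∈ G t 0 N, (q : ℝ) * c t x q := by
  have hinj : Set.InjOn (fun q : ℚ => (q.num.toNat, q.den)) (G t 0 N : Finset ℚ) := by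
    intro p hp q hq h
    rw [Finset.mem_coe, mem_G] at hp hq
    have h1 := Rat.num_nonneg.mpr hp.1
    have h2 := Rat.num_nonneg.mpr hq.1
    simp only [Prod.mk.injEq] at h
    exact Rat.ext (by omega) h.2
  unfold gR
  rw [tsum_eq_sum (s := (G t 0 N).image (fun q : ℚ => (q.num.toNat, q.den))),
    Finset.sum_image hinj]
  · apply Finset.sum_congr rfl
    intro q hq
    rw [mem_G] at hq
    obtain ⟨h1, h2, h3⟩ := hq
    rcases h1.eq_or_lt with h0 | h0
    · subst h0; simp
    have hn : 0 < q.num := Rat.num_pos.mpr h0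
    obtain ⟨n, hnn⟩ := Int.eq_ofNat_of_zero_le hn.le
    have hcop := q.reduced
    have hq' := Rat.num_div_den q
    simp only [hnn, Int.toNat_natCast, Int.ofNat_eq_natCast] at *
    have hd := q.den_pos
    rw [if_pos ⟨by omega, hd, h3, by simpa using hcop⟩, leftEnd_eq t ht _ _ (by omega) hd]
    push_cast at hq'
    rw [hq']
    have : (n : ℝ) / (q.den : ℝ) = (q : ℝ) := by
      conv_rhs => rw [← hq']
      push_cast; rfl
    rw [this]; rfl
  · rintro ⟨n, d⟩ hp
    split_ifs with h
    · obtain ⟨h1, h2, h3, h4⟩ := h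
      simp only at h1 h2 h3 h4 ⊢
      rw [leftEnd_eq t ht _ _ h1 h2]
      have e1 := Rat.den_div_eq_of_coprime (a := n) (b := d) (by exact_mod_cast h2)
        (by simpa using h4)
      have e2 := Rat.num_div_eq_of_coprime (a := n) (b := d) (by exact_mod_cast h2)
        (by simpa using h4)
      simp only [Int.cast_natCast] at e1 e2
      have e : ((n : ℚ) / d).den = d := by exact_mod_cast e1
      have hge : (N : ℚ) ≤ (n : ℚ) / d := by
        by_contra hlt
        push Not at hlt
        apply hp
        rw [Finset.mem_image]
        refine ⟨(n : ℚ) / d, mem_G.mpr ⟨by positivity, hlt, by rw [e]; exact h3⟩, ?_⟩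
        rw [e, e2]; simp
      have := L_mono t (by positivity) hge
      rw [max_eq_right (by linarith), min_eq_left (by positivity), mul_zero]
    · rfl

theorem L_one_ge (t : ℕ) (ht : 0 < t) : (t : ℝ) ≤ L t 1 := by
  unfold L
  rw [← l_zero]
  exact Finset.single_le_sum (f := l t) (fun r _ => l_nonneg t r) (zero_mem t ht one_pos)

noncomputable def A (t : ℕ) (y : ℝ) : ℝ := ∑ q ∈ G t 0 1, (q : ℝ) * c t y q

theorem gR_shift (t : ℕ) (ht : 0 < t) (x : ℝ) :
    gR t (x + L t 1) = A t (x + L t 1) + gR t x + max x 0 := by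
  have hH := L_one_ge t ht
  have ht' : (0 : ℝ) < t := by exact_mod_cast ht
  obtain ⟨N, hN⟩ := exists_nat_ge (max x 0 / L t 1)
  rw [div_le_iff₀ (by linarith), ← L_nat] at hN
  have hx : x ≤ L t N := le_trans (le_max_left _ _) hN
  have hx2 : x + L t 1 ≤ L t (N + 1 : ℕ) := by
    push_cast; rw [L_add_one t (by positivity)]; linarith
  rw [gR_eq t ht x N hx, gR_eq t ht _ (N + 1) hx2]
  push_cast
  rw [sum_split t _ (v := 1) zero_le_one (by have : (0 : ℚ) ≤ N := by positivity
                                             linarith)]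
  have h := sum_shift t (fun q => (q : ℝ) * c t (x + L t 1) q) 0 N
  rw [zero_add] at h
  rw [h]
  have h2 : ∑ r ∈ G t 0 N, ((r + 1 : ℚ) : ℝ) * c t (x + L t 1) (r + 1)
      = ∑ r ∈ G t 0 N, (r : ℝ) * c t x r + ∑ r ∈ G t 0 N, c t x r := by
    rw [← Finset.sum_add_distrib]
    apply Finset.sum_congr rfl
    intro r hr
    rw [c_shift t x (mem_G.mp hr).1]; push_cast; ring
  rw [h2, tile, min_eq_left hN]
  unfold A; ring

theorem sum_refl (t : ℕ) (f : ℚ → ℝ) :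
    ∑ q ∈ (G t 0 1).erase 0, f (1 - q) = ∑ q ∈ (G t 0 1).erase 0, f q := by
  refine Finset.sum_bij' (fun q _ => 1 - q) (fun q _ => 1 - q) ?_ ?_ ?_ ?_ ?_
  · intro q; simp only [Finset.mem_erase, mem_G, den_one_sub]; grind
  · intro q; simp only [Finset.mem_erase, mem_G, den_one_sub]; grind
  · simp
  · simp
  · simp

theorem L_refl (t : ℕ) (ht : 0 < t) {q : ℚ} (hq : q ∈ (G t 0 1).erase 0) :
    L t (1 - q) + l t q + L t q = L t 1 + t := by
  rw [Finset.mem_erase, mem_G] at hq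
  obtain ⟨h0, h1, h2, h3⟩ := hq
  have h0' : 0 < q := lt_of_le_of_ne h1 (Ne.symm h0)
  have hs := sum_split t (l t) h1 h2.le
  have hqm : q ∈ G t q 1 := mem_G.mpr ⟨le_rfl, h2, h3⟩
  rw [← Finset.add_sum_erase _ _ hqm] at hs
  have hs2 : L t (1 - q) = t + ∑ r ∈ (G t q 1).erase q, l t r := by
    unfold L
    rw [← Finset.add_sum_erase _ _ (zero_mem t ht (by linarith)), l_zero]
    congr 1
    refine Finset.sum_bij' (fun q _ => 1 - q) (fun q _ => 1 - q) ?_ ?_ ?_ ?_ ?_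
    · intro q; simp only [Finset.mem_erase, mem_G, den_one_sub]; grind
    · intro q; simp only [Finset.mem_erase, mem_G, den_one_sub]; grind
    · simp
    · simp
    · intro r _; simp [l, den_one_sub]
  unfold L at *
  linarith

theorem A_diff (t : ℕ) (ht : 0 < t) (x : ℝ) :
    A t (x + L t 1) - A t (t - x) =
      min (max (x + L t 1) 0) (L t 1) - min (max (x + L t 1) 0) t - (L t 1 - t) / 2 := by
  have hz := zero_mem t ht (v := 1) one_pos
  have hA : ∀ y, A t y = ∑ q ∈ (G t 0 1).erase 0, (q : ℝ) * c t y q := by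
    intro y; unfold A; rw [← Finset.add_sum_erase _ _ hz]; simp
  have hc : ∀ q ∈ (G t 0 1).erase 0, c t (t - x) q = l t q - c t (x + L t 1) (1 - q) := by
    intro q hq
    have h := L_refl t ht hq
    have hl := l_nonneg t q
    have e : l t (1 - q) = l t q := by simp [l, den_one_sub]
    unfold c
    rw [e]
    grind
  have hT := tile t (x + L t 1) 1
  rw [← Finset.add_sum_erase _ _ hz] at hT
  have hc0 : c t (x + L t 1) 0 = min (max (x + L t 1) 0) t := by
    simp [c, L_zero, l_zero]
  have hl1 : L t 1 = t + ∑ q ∈ (G t 0 1).erase 0, l t q := by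
    conv_lhs => unfold L
    rw [← Finset.add_sum_erase _ _ hz, l_zero]
  have hl2 : ∑ q ∈ (G t 0 1).erase 0, (q : ℝ) * l t q
      = (∑ q ∈ (G t 0 1).erase 0, l t q) / 2 := by
    have h := sum_refl t (fun q => (q : ℝ) * l t q)
    have h' : ∑ q ∈ (G t 0 1).erase 0, ((1 - q : ℚ) : ℝ) * l t (1 - q) =
      ∑ q ∈ (G t 0 1).erase 0, l t q - ∑ q ∈ (G t 0 1).erase 0, (q : ℝ) * l t q := by
      rw [← Finset.sum_sub_distrib]
      apply Finset.sum_congr rfl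
      intro q _
      have e : l t (1 - q) = l t q := by simp [l, den_one_sub]
      rw [e]; push_cast; ring
    linarith
  have h3 : A t (t - x) = ∑ q ∈ (G t 0 1).erase 0, (q : ℝ) * l t q
      - ∑ q ∈ (G t 0 1).erase 0, (1 - (q : ℝ)) * c t (x + L t 1) q := by
    have h := sum_refl t (fun q => (1 - (q : ℝ)) * c t (x + L t 1) q)
    rw [← h, hA, ← Finset.sum_sub_distrib]
    apply Finset.sum_congr rfl
    intro q hq
    rw [hc q hq]; push_cast; ring
  have h4 : ∑ q ∈ (G t 0 1).erase 0, (1 - (q : ℝ)) * c t (x + L t 1) q =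
      ∑ q ∈ (G t 0 1).erase 0, c t (x + L t 1) q
      - ∑ q ∈ (G t 0 1).erase 0, (q : ℝ) * c t (x + L t 1) q := by
    rw [← Finset.sum_sub_distrib]
    apply Finset.sum_congr rfl
    intro q hq
    ring
  have h5 := hA (x + L t 1)
  linarith

theorem gR_zero (t : ℕ) (ht : 0 < t) {x : ℝ} (hx : x ≤ t) : gR t x = 0 := by
  have hH := L_one_ge t ht
  rw [gR_eq t ht x 1 (by simpa using hx.trans hH)]
  apply Finset.sum_eq_zero
  intro q hq
  rw [mem_G] at hq
  rcases hq.1.eq_or_lt with h0 | h0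
  · subst h0; simp
  have : (t : ℝ) ≤ L t q := by
    unfold L
    rw [← l_zero]
    exact Finset.single_le_sum (f := l t) (fun r _ => l_nonneg t r) (zero_mem t ht h0)
  unfold c
  rw [max_eq_right (by linarith), min_eq_left (l_nonneg t q), mul_zero]

theorem gp_eq (t : ℕ) (ht : 0 < t) (x : ℝ) : gridParabola t x = gR t x + gR t (t - x) := by
  have ht' : (0 : ℝ) < t := by exact_mod_cast ht
  unfold gridParabola
  split_ifs with h
  · rw [gR_zero t ht (x := x) (by linarith)]; ring
  · rw [gR_zero t ht (x := t - x) (by linarith)]; ring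

end GP

/-- Horizontal periodicity of the grid parabola:
g_t(x + H_t) = g_t(x) + x + (H_t - t)/2. -/
theorem gridParabola_periodicity (t : ℕ) (ht : 0 < t) (x : ℝ) :
    gridParabola t (x + (Hper t : ℝ))
      = gridParabola t x + x + ((Hper t : ℝ) - (t : ℝ)) / 2 := by
  rw [GP.Hper_eq, GP.gp_eq t ht, GP.gp_eq t ht]
  have h1 := GP.gR_shift t ht x
  have h2 := GP.gR_shift t ht (t - (x + GP.L t 1))
  rw [show (t : ℝ) - (x + GP.L t 1) + GP.L t 1 = t - x by ring] at h2
  have h3 := GP.A_diff t ht x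
  have h4 := GP.L_one_ge t ht
  have ht' : (0 : ℝ) < t := by exact_mod_cast ht
  have h5 : max x 0 - max (t - (x + GP.L t 1)) 0 + min (max (x + GP.L t 1) 0) (GP.L t 1)
      - min (max (x + GP.L t 1) 0) t = x + (GP.L t 1 - t) := by
    grind
  linarith
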